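/- Let R' = {α_1,…,α_n} be pairwise orthogonal nonzero vectors in ℝ^N, κ_j > 0, and define the multivariable intertwining operator χ_κ f(x) = (1/∏_j Γ(κ_j)) ∫_{[0,1]^n} f(h(t,x)) ∏_j (1-t_j)^{κ_j-1} dt, where h(t,x) = x + Σ_j (t_j - 1)(⟨x,α_j⟩/|α_j|²) α_j. Then for every f ∈ C^∞(ℝ^N) and ξ ∈ ℝ^N, T_ξ(χ_κ f) = χ_κ(∂_ξ f), where T_ξ g(x) = ∂_ξ g(x) + Σ_j κ_j ⟨α_j,ξ⟩ (g(x)-g(τ_{α_j}x))/⟨x,α_j⟩. -/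

import Mathlib

open RealInnerProductSpace

/-- The Dunkl-type operator `T_ξ` associated to a family of pairwise orthogonal
roots `α` and multiplicity parameters `κ`.  The difference quotient
`(g(x) - g(τ_{α_j} x)) / ⟨x, α_j⟩` is written via its (smooth) integral
representation `(1/|α_j|²) ∫₀¹ ∂_{α_j} g(x - t (⟨x,α_j⟩/|α_j|²) α_j) dt`. -/
noncomputable def Txi {N n : ℕ} (α : Fin n → EuclideanSpace ℝ (Fin N))
    (κ : Fin n → ℂ) (ξ : EuclideanSpace ℝ (Fin N))
    (g : EuclideanSpace ℝ (Fin N) → ℂ) (x : EuclideanSpace ℝ (Fin N)) : ℂ :=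
  fderiv ℝ g x ξ + ∑ j, κ j *
    ((⟪α j, ξ⟫ / ‖α j‖ ^ 2 : ℝ) •
      ∫ t in (0:ℝ)..1,
        fderiv ℝ g (x - ((t * ⟪x, α j⟫) / ‖α j‖ ^ 2) • α j) (α j))

/-- The map `h(t,x) = x + Σ_j (t_j - 1)(⟨x,α_j⟩/|α_j|²) α_j`. -/
noncomputable def hMap {N n : ℕ} (α : Fin n → EuclideanSpace ℝ (Fin N))
    (t : Fin n → ℝ) (x : EuclideanSpace ℝ (Fin N)) : EuclideanSpace ℝ (Fin N) :=
  x + ∑ j, ((t j - 1) * (⟪x, α j⟫ / ‖α j‖ ^ 2)) • α j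

/-- The multivariable intertwining operator `χ_κ`, an integral over the unit
cube `[0,1]^n`. -/
noncomputable def chiKappa {N n : ℕ} (α : Fin n → EuclideanSpace ℝ (Fin N))
    (κ : Fin n → ℝ) (f : EuclideanSpace ℝ (Fin N) → ℂ)
    (x : EuclideanSpace ℝ (Fin N)) : ℂ :=
  (∏ j, Real.Gamma (κ j))⁻¹ •
    ∫ t in Set.Icc (0 : Fin n → ℝ) 1,
      (∏ j, (1 - t j) ^ (κ j - 1)) • f (hMap α t x)

open MeasureTheory Set

theorem measurePreserving_update_prod {ι : Type*} [Fintype ι] [DecidableEq ι] {X : ι → Type*}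
    [∀ i, MeasurableSpace (X i)] (μ : ∀ i, Measure (X i)) [∀ i, IsProbabilityMeasure (μ i)]
    (j : ι) :
    MeasurePreserving (fun p : (∀ i, X i) × X j => Function.update p.1 j p.2)
      ((Measure.pi μ).prod (μ j)) (Measure.pi μ) := by
  refine ⟨measurable_update', (Measure.pi_eq fun s hs => ?_).symm⟩
  have hpre : (fun p : (∀ i, X i) × X j => Function.update p.1 j p.2) ⁻¹' (univ.pi s) =
      (univ.pi (Function.update s j univ)) ×ˢ s j := by
    ext ⟨t, r⟩
    simp only [mem_preimage, mem_pi, mem_univ, true_implies, mem_prod]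
    constructor
    · intro h
      refine ⟨fun i => ?_, by simpa using h j⟩
      by_cases hij : i = j
      · subst hij; simp
      · simpa [hij] using h i
    · rintro ⟨h, hr⟩ i
      by_cases hij : i = j
      · subst hij; simpa using hr
      · simpa [hij] using h i
  rw [Measure.map_apply measurable_update' (MeasurableSet.univ_pi hs), hpre, Measure.prod_prod,
    Measure.pi_pi, ← Finset.mul_prod_erase _ _ (Finset.mem_univ j),
    ← Finset.mul_prod_erase _ _ (Finset.mem_univ j)]
  simp only [Function.update_self, measure_univ, one_mul]
  rw [mul_comm]
  congr 1
  refine Finset.prod_congr rfl fun i hi => ?_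
  rw [Function.update_of_ne (Finset.ne_of_mem_erase hi)]

theorem integral_pi_eq_integral_update {ι E : Type*} [Fintype ι] [DecidableEq ι] {X : ι → Type*}
    [∀ i, MeasurableSpace (X i)] [NormedAddCommGroup E] [NormedSpace ℝ E]
    (μ : ∀ i, Measure (X i)) [∀ i, IsProbabilityMeasure (μ i)] (j : ι)
    {φ : (∀ i, X i) → E} (hφ : Integrable φ (Measure.pi μ)) :
    ∫ t, φ t ∂Measure.pi μ = ∫ t, ∫ r, φ (Function.update t j r) ∂μ j ∂Measure.pi μ := by
  have hmp := measurePreserving_update_prod μ j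
  have h1 : ∫ t, φ t ∂Measure.pi μ =
      ∫ p, φ (Function.update p.1 j p.2) ∂(Measure.pi μ).prod (μ j) := by
    conv_lhs => rw [← hmp.map_eq]
    exact integral_map hmp.measurable.aemeasurable (by rw [hmp.map_eq]; exact hφ.1)
  rw [h1]
  exact integral_prod (fun p : (∀ i, X i) × X j => φ (Function.update p.1 j p.2))
    ((hmp.integrable_comp hφ.1).2 hφ)

theorem intervalIntegrable_one_sub_rpow {r : ℝ} (hr : -1 < r) :
    IntervalIntegrable (fun t : ℝ => (1 - t) ^ r) volume 0 1 := by
  have := (intervalIntegral.intervalIntegrable_rpow' (a := 0) (b := 1) hr).comp_sub_left 1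
  simpa using this.symm

theorem integral_one_sub_rpow_smul_primitive {E : Type*} [NormedAddCommGroup E]
    [NormedSpace ℝ E] [CompleteSpace E] {κ : ℝ} (hκ : 0 < κ) {G F : ℝ → E} (hF : Continuous F)
    (hG : ∀ t, HasDerivAt G (F t) t) (hG0 : G 0 = 0) :
    ∫ t in (0:ℝ)..1, (κ * (1 - t) ^ (κ - 1)) • G t = ∫ t in (0:ℝ)..1, (1 - t) ^ κ • F t := by
  have hcont : Continuous fun t : ℝ => -(1 - t) ^ κ :=
    ((continuous_const.sub continuous_id).rpow_const fun _ => Or.inr hκ.le).neg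
  have h := intervalIntegral.integral_smul_deriv_eq_deriv_smul_of_hasDerivAt
    (a := 0) (b := 1) (u := fun t : ℝ => -(1 - t) ^ κ)
    (u' := fun t : ℝ => κ * (1 - t) ^ (κ - 1)) (v := G) (v' := F)
    hcont.continuousOn
    (fun t _ => (hG t).continuousAt.continuousWithinAt)
    (fun t ht => by
      have ht1 : 1 - t ≠ 0 := by
        simp only [zero_le_one, sup_of_le_right, mem_Ioo] at ht
        linarith [ht.2]
      have := (((hasDerivAt_id t).const_sub 1).rpow_const (p := κ) (Or.inl ht1)).neg
      exact this.congr_deriv (by simp))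
    (fun t _ => hG t)
    ((intervalIntegrable_one_sub_rpow (by linarith)).const_mul κ)
    (hF.intervalIntegrable _ _)
  simp only [neg_smul, intervalIntegral.integral_neg, hG0, sub_self, Real.zero_rpow hκ.ne',
    smul_zero, neg_zero, zero_smul, zero_sub] at h
  exact (neg_injective h).symm

theorem smul_integral_comp_mul_one_sub {E : Type*} [NormedAddCommGroup E] [NormedSpace ℝ E]
    [CompleteSpace E] (F : ℝ → E) (t : ℝ) :
    t • ∫ s in (0:ℝ)..1, F (t * (1 - s)) = ∫ u in (0:ℝ)..t, F u := by
  have h := intervalIntegral.integral_comp_sub_left (a := 0) (b := 1) (fun s => F (t * s)) 1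
  simp only [sub_self, sub_zero] at h
  rw [h, intervalIntegral.smul_integral_comp_mul_left]
  simp

theorem integral_rpow_smul_average {E : Type*} [NormedAddCommGroup E]
    [NormedSpace ℝ E] [CompleteSpace E] {κ : ℝ} (hκ : 0 < κ) {F : ℝ → E} (hF : Continuous F) :
    ∫ t in (0:ℝ)..1, (κ * (1 - t) ^ (κ - 1)) • t • ∫ s in (0:ℝ)..1, F (t * (1 - s)) =
      ∫ t in (0:ℝ)..1, (1 - t) ^ κ • F t := by
  simp_rw [smul_integral_comp_mul_one_sub]
  exact integral_one_sub_rpow_smul_primitive hκ hF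
    (fun t => hF.integral_hasStrictDerivAt 0 t |>.hasDerivAt) (by simp)

instance isProbabilityMeasure_restrict_Icc_zero_one :
    IsProbabilityMeasure (volume.restrict (Icc (0:ℝ) 1)) := ⟨by simp⟩

theorem volume_restrict_Icc_pi (ι : Type*) [Fintype ι] :
    (volume : Measure (ι → ℝ)).restrict (Icc 0 1) =
      Measure.pi fun _ => volume.restrict (Icc (0:ℝ) 1) := by
  rw [volume_pi, ← Measure.restrict_pi_pi, ← Set.pi_univ_Icc]
  rfl

theorem integrableOn_prod_one_sub_rpow {ι : Type*} [Fintype ι] {κ : ι → ℝ} (hκ : ∀ j, 0 < κ j) :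
    IntegrableOn (fun t : ι → ℝ => ∏ j, (1 - t j) ^ (κ j - 1)) (Icc 0 1) := by
  rw [IntegrableOn, volume_restrict_Icc_pi]
  refine Integrable.fintype_prod (f := fun j (s : ℝ) => (1 - s) ^ (κ j - 1)) fun j => ?_
  have h := intervalIntegrable_one_sub_rpow (r := κ j - 1) (by linarith [hκ j])
  rw [intervalIntegrable_iff_integrableOn_Icc_of_le zero_le_one] at h
  exact h

theorem hasFDerivAt_setIntegral_smul {T E G : Type*} [TopologicalSpace T]
    [MeasurableSpace T] [OpensMeasurableSpace T] [T2Space T] [SecondCountableTopology T]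
    [NormedAddCommGroup E] [NormedSpace ℝ E] [ProperSpace E] [NormedAddCommGroup G] [NormedSpace ℝ G]
    {μ : Measure T} {K : Set T} (hK : IsCompact K) {w : T → ℝ} (hw : IntegrableOn w K μ)
    {F : T → E → G} {F' : T → E → E →L[ℝ] G} (hF : Continuous (Function.uncurry F))
    (hF' : Continuous (Function.uncurry F')) (hd : ∀ t x, HasFDerivAt (F t) (F' t x) x) (x : E) :
    HasFDerivAt (fun y => ∫ t in K, w t • F t y ∂μ) (∫ t in K, w t • F' t x ∂μ) x := by
  obtain ⟨M, hM⟩ := (hK.prod (isCompact_closedBall x 1)).exists_bound_of_continuousOn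
    hF'.continuousOn
  have hFy : ∀ y, IntegrableOn (fun t => w t • F t y) K μ := fun y =>
    hw.smul_continuousOn (hF.comp (Continuous.prodMk_left y)).continuousOn hK
  refine hasFDerivAt_integral_of_dominated_of_fderiv_le (F' := fun y t => w t • F' t y)
    (bound := fun t => ‖w t‖ * M)
    (Metric.closedBall_mem_nhds x one_pos) (.of_forall fun y => (hFy y).1) (hFy x)
    (hw.smul_continuousOn (hF'.comp (Continuous.prodMk_left x)).continuousOn hK).1 ?_
    (hw.norm.mul_const M) (.of_forall fun t y _ => (hd t y).const_smul (w t))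
  refine (ae_restrict_iff' hK.measurableSet).2 (.of_forall fun t ht y hy => ?_)
  rw [norm_smul]
  exact mul_le_mul_of_nonneg_left (hM (t, y) ⟨ht, hy⟩) (norm_nonneg _)

theorem prod_comp_update {ι M X : Type*} [Fintype ι] [DecidableEq ι] [CommMonoid M]
    (g : ι → X → M) (t : ι → X) (j : ι) (r : X) :
    ∏ i, g i (Function.update t j r i) = (∏ i ∈ Finset.univ.erase j, g i (t i)) * g j r := by
  rw [← Finset.prod_erase_mul _ _ (Finset.mem_univ j), Function.update_self]
  congr 1
  refine Finset.prod_congr rfl fun i hi => ?_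
  rw [Function.update_of_ne (Finset.ne_of_mem_erase hi)]

theorem integral_cube_rpow_smul_average {ι E : Type*} [Fintype ι] [DecidableEq ι]
    [NormedAddCommGroup E] [NormedSpace ℝ E] [CompleteSpace E] {κ : ι → ℝ} (hκ : ∀ j, 0 < κ j)
    {A : (ι → ℝ) → E} (hA : Continuous A) (j : ι) :
    κ j • ∫ s in (0:ℝ)..1, ∫ t in Icc (0 : ι → ℝ) 1, (∏ i, (1 - t i) ^ (κ i - 1)) •
        t j • A (Function.update t j (t j * (1 - s))) =
      ∫ t in Icc (0 : ι → ℝ) 1, (∏ i, (1 - t i) ^ (κ i - 1)) • (1 - t j) • A t := by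
  have hw := integrableOn_prod_one_sub_rpow hκ
  have hB : Continuous fun p : ℝ × (ι → ℝ) =>
      p.2 j • A (Function.update p.2 j (p.2 j * (1 - p.1))) := by
    have : Continuous fun p : ℝ × (ι → ℝ) => Function.update p.2 j (p.2 j * (1 - p.1)) :=
      continuous_snd.update j (by fun_prop)
    fun_prop
  have havg : Continuous fun t : ι → ℝ =>
      t j • ∫ s in (0:ℝ)..1, A (Function.update t j (t j * (1 - s))) := by
    refine (continuous_apply j).smul ?_
    refine intervalIntegral.continuous_parametric_intervalIntegral_of_continuous' ?_ 0 1
    exact hA.comp (continuous_fst.update j (by fun_prop))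
  have hswap : ∫ s in (0:ℝ)..1, ∫ t in Icc (0 : ι → ℝ) 1, (∏ i, (1 - t i) ^ (κ i - 1)) •
        t j • A (Function.update t j (t j * (1 - s))) =
      ∫ t in Icc (0 : ι → ℝ) 1, (∏ i, (1 - t i) ^ (κ i - 1)) •
        t j • ∫ s in (0:ℝ)..1, A (Function.update t j (t j * (1 - s))) := by
    simp only [intervalIntegral.integral_of_le zero_le_one, ← integral_Icc_eq_integral_Ioc]
    rw [integral_integral_swap]
    · simp only [integral_smul]
    · have h2 : IntegrableOn (fun p : ℝ × (ι → ℝ) => ∏ i, (1 - p.2 i) ^ (κ i - 1))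
          (Icc 0 1 ×ˢ Icc 0 1) (volume.prod volume) := by
        rw [IntegrableOn, ← Measure.prod_restrict]
        exact Integrable.comp_snd hw _
      have h3 := h2.smul_continuousOn hB.continuousOn (isCompact_Icc.prod isCompact_Icc)
      rw [IntegrableOn, ← Measure.prod_restrict] at h3
      exact h3
  have hL := hw.smul_continuousOn havg.continuousOn isCompact_Icc
  have hR := hw.smul_continuousOn (g := fun t => (1 - t j) • A t)
    (Continuous.continuousOn (by fun_prop)) isCompact_Icc
  rw [IntegrableOn, volume_restrict_Icc_pi] at hL hR
  rw [hswap, volume_restrict_Icc_pi, integral_pi_eq_integral_update _ j hL,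
    integral_pi_eq_integral_update _ j hR, ← integral_smul]
  congr 1
  ext t
  have h1 := integral_rpow_smul_average (hκ j)
    (F := fun r => A (Function.update t j r)) (hA.comp (continuous_const.update j continuous_id))
  simp only [prod_comp_update (fun i (x : ℝ) => (1 - x) ^ (κ i - 1)), mul_smul,
    integral_smul, Function.update_self, Function.update_idem]
  rw [smul_comm]
  congr 1
  rw [← integral_smul]
  simp only [integral_Icc_eq_integral_Ioc, ← mul_smul (κ j)]
  rw [← intervalIntegral.integral_of_le zero_le_one, h1,
    ← intervalIntegral.integral_of_le zero_le_one]
  refine intervalIntegral.integral_congr fun r hr => ?_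
  simp only [← mul_smul]
  congr 1
  rw [uIcc_of_le zero_le_one] at hr
  rcases hr.2.lt_or_eq with h | h
  · rw [Real.rpow_sub_one (by linarith), div_mul_cancel₀ _ (by linarith)]
  · simp [h, Real.zero_rpow (hκ j).ne']

/-- The map `hMap α t` as a continuous linear map. -/
noncomputable def hMapCLM {N n : ℕ} (α : Fin n → EuclideanSpace ℝ (Fin N)) (t : Fin n → ℝ) :
    EuclideanSpace ℝ (Fin N) →L[ℝ] EuclideanSpace ℝ (Fin N) :=
  ContinuousLinearMap.id ℝ _ +
    ∑ j, ((t j - 1) / ‖α j‖ ^ 2) • (innerSL ℝ (α j)).smulRight (α j)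

theorem hMapCLM_apply {N n : ℕ} (α : Fin n → EuclideanSpace ℝ (Fin N)) (t : Fin n → ℝ)
    (x : EuclideanSpace ℝ (Fin N)) : hMapCLM α t x = hMap α t x := by
  simp only [hMapCLM, hMap, add_apply, ContinuousLinearMap.id_apply,
    sum_apply, smul_apply,
    ContinuousLinearMap.smulRight_apply, innerSL_apply_apply, smul_smul]
  congr 1
  refine Finset.sum_congr rfl fun j _ => ?_
  rw [real_inner_comm]
  congr 1
  ring

theorem continuous_hMapCLM {N n : ℕ} (α : Fin n → EuclideanSpace ℝ (Fin N)) :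
    Continuous (hMapCLM α) := by
  unfold hMapCLM
  fun_prop

theorem continuous_hMap {N n : ℕ} (α : Fin n → EuclideanSpace ℝ (Fin N)) :
    Continuous fun p : (Fin n → ℝ) × EuclideanSpace ℝ (Fin N) => hMap α p.1 p.2 := by
  unfold hMap
  fun_prop

theorem hMap_root {N n : ℕ} {α : Fin n → EuclideanSpace ℝ (Fin N)}
    (horth : ∀ i j, i ≠ j → ⟪α i, α j⟫ = 0) {j : Fin n} (hα : α j ≠ 0) (t : Fin n → ℝ) :
    hMap α t (α j) = t j • α j := by
  have hn : ‖α j‖ ^ 2 ≠ 0 := by simpa using hα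
  rw [hMap, Finset.sum_eq_single j]
  · rw [real_inner_self_eq_norm_sq, div_self hn, mul_one, sub_smul, one_smul]
    abel
  · intro i _ hij
    simp [horth j i hij.symm]
  · simp

theorem hMap_sub_smul_root {N n : ℕ} {α : Fin n → EuclideanSpace ℝ (Fin N)}
    (horth : ∀ i j, i ≠ j → ⟪α i, α j⟫ = 0) {j : Fin n} (hα : α j ≠ 0) (t : Fin n → ℝ) (s : ℝ)
    (x : EuclideanSpace ℝ (Fin N)) :
    hMap α t (x - ((s * ⟪x, α j⟫) / ‖α j‖ ^ 2) • α j) =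
      hMap α (Function.update t j (t j * (1 - s))) x := by
  rw [← hMapCLM_apply, map_sub, map_smul, hMapCLM_apply, hMapCLM_apply, hMap_root horth hα,
    hMap, hMap, ← Finset.add_sum_erase _ _ (Finset.mem_univ j),
    ← Finset.add_sum_erase (a := j) _ (fun i => ((Function.update t j (t j * (1 - s)) i - 1) * _) • _)
      (Finset.mem_univ j), Function.update_self,
    Finset.sum_congr rfl fun i (hi : i ∈ Finset.univ.erase j) => by
      rw [← Function.update_of_ne (Finset.ne_of_mem_erase hi) (t j * (1 - s)) t]]
  module

theorem hasFDerivAt_chiKappa {N n : ℕ} (α : Fin n → EuclideanSpace ℝ (Fin N))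
    {κ : Fin n → ℝ} (hκ : ∀ j, 0 < κ j) {f : EuclideanSpace ℝ (Fin N) → ℂ} (hf : ContDiff ℝ 1 f)
    (x : EuclideanSpace ℝ (Fin N)) :
    HasFDerivAt (chiKappa α κ f) ((∏ j, Real.Gamma (κ j))⁻¹ •
      ∫ t in Icc (0 : Fin n → ℝ) 1, (∏ j, (1 - t j) ^ (κ j - 1)) •
        (fderiv ℝ f (hMap α t x)).comp (hMapCLM α t)) x := by
  have hf' : Continuous (fderiv ℝ f) := hf.continuous_fderiv one_ne_zero
  refine (hasFDerivAt_setIntegral_smul (F := fun t y => f (hMap α t y))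
    (F' := fun t y => (fderiv ℝ f (hMap α t y)).comp (hMapCLM α t)) isCompact_Icc
    (integrableOn_prod_one_sub_rpow hκ) (hf.continuous.comp (continuous_hMap α))
    ((hf'.comp (continuous_hMap α)).clm_comp ((continuous_hMapCLM α).comp continuous_fst))
    (fun t y => ?_) x).const_smul ((∏ j, Real.Gamma (κ j))⁻¹)
  simp only [← hMapCLM_apply]
  exact ((hf.differentiable one_ne_zero _).hasFDerivAt).comp y (hMapCLM α t).hasFDerivAt

theorem fderiv_chiKappa_apply {N n : ℕ} (α : Fin n → EuclideanSpace ℝ (Fin N))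
    {κ : Fin n → ℝ} (hκ : ∀ j, 0 < κ j) {f : EuclideanSpace ℝ (Fin N) → ℂ} (hf : ContDiff ℝ 1 f)
    (x v : EuclideanSpace ℝ (Fin N)) :
    fderiv ℝ (chiKappa α κ f) x v = (∏ j, Real.Gamma (κ j))⁻¹ •
      ∫ t in Icc (0 : Fin n → ℝ) 1, (∏ j, (1 - t j) ^ (κ j - 1)) •
        fderiv ℝ f (hMap α t x) (hMap α t v) := by
  have hf' : Continuous (fderiv ℝ f) := hf.continuous_fderiv one_ne_zero
  rw [(hasFDerivAt_chiKappa α hκ hf x).fderiv, smul_apply,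
    ContinuousLinearMap.integral_apply]
  · simp [hMapCLM_apply]
  · exact (integrableOn_prod_one_sub_rpow hκ).smul_continuousOn
      (((hf'.comp ((continuous_hMap α).comp (Continuous.prodMk_left x))).clm_comp
        (continuous_hMapCLM α)).continuousOn) isCompact_Icc

theorem chiKappa_intertwines_multivariable {N n : ℕ}
    (α : Fin n → EuclideanSpace ℝ (Fin N)) (hα : ∀ j, α j ≠ 0)
    (horth : ∀ i j, i ≠ j → ⟪α i, α j⟫ = 0)
    (κ : Fin n → ℝ) (hκ : ∀ j, 0 < κ j)
    (f : EuclideanSpace ℝ (Fin N) → ℂ) (hf : ContDiff ℝ (⊤ : ℕ∞) f)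
    (ξ : EuclideanSpace ℝ (Fin N)) :
    ∀ x, Txi α (fun j => (κ j : ℂ)) ξ (chiKappa α κ f) x =
      chiKappa α κ (fun y => fderiv ℝ f y ξ) x := by
  intro x
  have hf1 : ContDiff ℝ 1 f := hf.of_le (by exact_mod_cast le_top)
  have hf' : Continuous (fderiv ℝ f) := hf1.continuous_fderiv one_ne_zero
  have hA : ∀ v, Continuous fun t : Fin n → ℝ => fderiv ℝ f (hMap α t x) v := fun v =>
    (hf'.comp ((continuous_hMap α).comp (Continuous.prodMk_left x))).clm_apply continuous_const
  have hw := integrableOn_prod_one_sub_rpow hκ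
  have hroot : ∀ j, (κ j : ℂ) * ((⟪α j, ξ⟫ / ‖α j‖ ^ 2 : ℝ) • ∫ s in (0:ℝ)..1,
        fderiv ℝ (chiKappa α κ f) (x - ((s * ⟪x, α j⟫) / ‖α j‖ ^ 2) • α j) (α j)) =
      (∏ j, Real.Gamma (κ j))⁻¹ • ∫ t in Icc (0 : Fin n → ℝ) 1,
        (∏ i, (1 - t i) ^ (κ i - 1)) •
          ((1 - t j) * (⟪ξ, α j⟫ / ‖α j‖ ^ 2)) • fderiv ℝ f (hMap α t x) (α j) := by
    intro j
    have h := integral_cube_rpow_smul_average hκ (hA (α j)) j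
    simp only [fderiv_chiKappa_apply α hκ hf1, hMap_root horth (hα j),
      hMap_sub_smul_root horth (hα j), map_smul, intervalIntegral.integral_smul]
    rw [← Complex.real_smul, smul_comm, smul_comm (κ j), h, smul_comm, ← integral_smul,
      real_inner_comm]
    congr 2
    ext t
    module
  have hint : ∀ j ∈ (Finset.univ : Finset (Fin n)), IntegrableOn (fun t : Fin n → ℝ =>
      (∏ i, (1 - t i) ^ (κ i - 1)) •
        ((1 - t j) * (⟪ξ, α j⟫ / ‖α j‖ ^ 2)) • fderiv ℝ f (hMap α t x) (α j)) (Icc 0 1) :=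
    fun j _ => by
      have hc : Continuous fun t : Fin n → ℝ => (1 - t j) * (⟪ξ, α j⟫ / ‖α j‖ ^ 2) := by fun_prop
      exact hw.smul_continuousOn (hc.smul (hA (α j))).continuousOn isCompact_Icc
  have hint0 : IntegrableOn (fun t : Fin n → ℝ => (∏ i, (1 - t i) ^ (κ i - 1)) •
      fderiv ℝ f (hMap α t x) (hMap α t ξ)) (Icc 0 1) :=
    hw.smul_continuousOn
      ((hf'.comp ((continuous_hMap α).comp (Continuous.prodMk_left x))).clm_apply
        ((continuous_hMap α).comp (Continuous.prodMk_left ξ))).continuousOn isCompact_Icc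
  simp only [Txi, hroot]
  rw [fderiv_chiKappa_apply α hκ hf1, chiKappa, ← Finset.smul_sum, ← smul_add,
    ← integral_finsetSum _ hint, ← integral_add hint0 (integrable_finsetSum _ hint)]
  congr 2
  ext t
  rw [← Finset.smul_sum, ← smul_add]
  congr 1
  simp only [← map_smul]
  rw [← map_sum, ← map_add]
  refine congrArg _ ?_
  rw [hMap, add_assoc, ← Finset.sum_add_distrib, add_eq_left]
  refine Finset.sum_eq_zero fun j _ => ?_
  module
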